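/- Let n ≥ 2, let X = X₁×X₂×···×X_n be a product of Polish spaces, let P ∈ P(X) and let R ∈ P(X) be Markovian. Then H(P|R) ≥ Σ_{i=1}^{n−1} H(P_{i,i+1}|R_{i,i+1}) − Σ_{i=2}^{n−1} H(P_i|R_i), where P_i, R_i denote i-th marginals and P_{i,i+1}, R_{i,i+1} denote the marginals on X_i×X_{i+1}. -/

import Mathlib

open MeasureTheory ProbabilityTheory Filter Set
open scoped ENNReal NNReal BigOperators Topology Classical

noncomputable section

section MarkovConcat

variable {Y₁ Y₂ Y₃ : Type*}
  [MeasurableSpace Y₁] [TopologicalSpace Y₁] [PolishSpace Y₁] [BorelSpace Y₁] [Nonempty Y₁]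
  [MeasurableSpace Y₂] [TopologicalSpace Y₂] [PolishSpace Y₂] [BorelSpace Y₂] [Nonempty Y₂]
  [MeasurableSpace Y₃] [TopologicalSpace Y₃] [PolishSpace Y₃] [BorelSpace Y₃] [Nonempty Y₃]

/-- Markov concatenation of `P₁₂ ∈ P(Y₁×Y₂)` and `P₂₃ ∈ P(Y₂×Y₃)`:
`(P₁₂ ∘ P₂₃)(dy₁ dy₂ dy₃) = P₁₂(dy₁|y₂) P₂(dy₂) P₂₃(dy₃|y₂)`, where `P₂ = (P₁₂)₂`. -/
def markovConcat (P12 : Measure (Y₁ × Y₂)) (P23 : Measure (Y₂ × Y₃))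
    [IsFiniteMeasure P12] [IsFiniteMeasure P23] : Measure (Y₁ × Y₂ × Y₃) :=
  ((P12.map Prod.snd) ⊗ₘ ((P12.map Prod.swap).condKernel ×ₖ P23.condKernel)).map
    fun p => (p.2.1, p.1, p.2.2)

end MarkovConcat

section Markovian

variable {X : ℕ → Type*} [∀ i, MeasurableSpace (X i)] [∀ i, TopologicalSpace (X i)]
  [∀ i, PolishSpace (X i)] [∀ i, BorelSpace (X i)] [∀ i, Nonempty (X i)]

/-- Evaluation of `ω ∈ X₀ × ⋯ × X_{n-1}` at coordinate `i` (junk value if `i ≥ n`). -/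
def coordFun {n : ℕ} (ω : ∀ j : Fin n, X j) (i : ℕ) : X i :=
  if h : i < n then ω ⟨i, h⟩ else Nonempty.some inferInstance

theorem measurable_coordFun {n i : ℕ} :
    Measurable fun ω : ∀ j : Fin n, X j => coordFun ω i := by
  unfold coordFun
  by_cases h : i < n
  · simp only [dif_pos h]; exact measurable_pi_apply _
  · simp only [dif_neg h]; exact measurable_const

/-- Projection onto the first `i` coordinates. -/
def frontFun {n : ℕ} (i : ℕ) (h : i ≤ n) (ω : ∀ j : Fin n, X j) : ∀ j : Fin i, X j :=
  fun j => ω (Fin.castLE h j)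

/-- Marginal of `Q` on the first `i` coordinates. -/
def frontMarg {n : ℕ} (Q : Measure (∀ j : Fin n, X j)) (i : ℕ) (h : i ≤ n) :
    Measure (∀ j : Fin i, X j) :=
  Q.map (frontFun i h)

/-- Marginal of `Q` on the first `i` coordinates together with the `i`-th coordinate,
seen as a measure on a product of two factors. -/
def frontPairMarg {n : ℕ} (Q : Measure (∀ j : Fin n, X j)) (i : ℕ) (h : i < n) :
    Measure ((∀ j : Fin i, X j) × X i) :=
  Q.map fun ω => (frontFun i h.le ω, coordFun ω i)

/-- Marginal of `Q` on the pair of adjacent coordinates `(i-1, i)`. -/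
def adjMarg {n : ℕ} (Q : Measure (∀ j : Fin n, X j)) (i : ℕ) :
    Measure (X (i - 1) × X i) :=
  Q.map fun ω => (coordFun ω (i - 1), coordFun ω i)

instance frontMarg.instIsFiniteMeasure {n : ℕ} (Q : Measure (∀ j : Fin n, X j))
    [IsFiniteMeasure Q] (i : ℕ) (h : i ≤ n) : IsFiniteMeasure (frontMarg Q i h) := by
  unfold frontMarg; infer_instance

instance frontPairMarg.instIsFiniteMeasure {n : ℕ} (Q : Measure (∀ j : Fin n, X j))
    [IsFiniteMeasure Q] (i : ℕ) (h : i < n) : IsFiniteMeasure (frontPairMarg Q i h) := by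
  unfold frontPairMarg; infer_instance

instance adjMarg.instIsFiniteMeasure {n : ℕ} (Q : Measure (∀ j : Fin n, X j))
    [IsFiniteMeasure Q] (i : ℕ) : IsFiniteMeasure (adjMarg Q i) := by
  unfold adjMarg; infer_instance

set_option synthInstance.maxHeartbeats 1000000 in
/-- `Q ∈ P(X₀ × ⋯ × X_{n-1})` is Markovian: for every `i` (0-indexed, `2 ≤ i ≤ n-1`), the
conditional law of the `i`-th coordinate given the previous ones coincides with its
conditional law given the `(i-1)`-th coordinate, i.e. the law of the first `i+1` coordinates
is the composition of the law of the first `i` coordinates with the kernel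
`(x₀,…,x_{i-1}) ↦ Q_{i-1,i}(· | x_{i-1})`. -/
def IsMarkovian {n : ℕ} (Q : Measure (∀ j : Fin n, X j)) [IsFiniteMeasure Q] : Prop :=
  ∀ i : ℕ, 2 ≤ i → ∀ hn : i < n,
    frontPairMarg Q i hn =
      (frontMarg Q i hn.le) ⊗ₘ
        ((adjMarg Q i).condKernel.comap
          (fun x : ∀ j : Fin i, X j => coordFun x (i - 1)) measurable_coordFun)

end Markovian

/-- Relative entropy `H(q|r)`, valued in `EReal`: it is `∫ log (dq/dr) dq` if `q ≪ r` and the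
log-likelihood ratio is `q`-integrable, and `+∞` otherwise. -/
def relEnt {Z : Type*} [MeasurableSpace Z] (q r : Measure Z) : EReal :=
  if q ≪ r ∧ Integrable (llr q r) q then ((∫ x, llr q r x ∂q : ℝ) : EReal) else ⊤

section Marginals

variable {X : ℕ → Type*} [∀ i, MeasurableSpace (X i)] [∀ i, TopologicalSpace (X i)]
  [∀ i, PolishSpace (X i)] [∀ i, BorelSpace (X i)] [∀ i, Nonempty (X i)]

/-- Marginal of `Q` on the `i`-th coordinate. -/
def singleMarg {n : ℕ} (Q : Measure (∀ j : Fin n, X j)) (i : ℕ) : Measure (X i) :=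
  Q.map fun ω => coordFun ω i

/-- Marginal of `Q` on the pair of coordinates `(i, i+1)`. -/
def pairMarg {n : ℕ} (Q : Measure (∀ j : Fin n, X j)) (i : ℕ) :
    Measure (X i × X (i + 1)) :=
  Q.map fun ω => (coordFun ω i, coordFun ω (i + 1))

end Marginals

theorem EReal.coe_ennreal_sum {ι : Type*} (s : Finset ι) (f : ι → ℝ≥0∞) :
    ((∑ i ∈ s, f i : ℝ≥0∞) : EReal) = ∑ i ∈ s, (f i : EReal) :=
  map_sum (⟨⟨((↑) : ℝ≥0∞ → EReal), EReal.coe_ennreal_zero⟩, EReal.coe_ennreal_add⟩ :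
    ℝ≥0∞ →+ EReal) f s

theorem relEnt_eq_klDiv {Z : Type*} [MeasurableSpace Z] (q r : Measure Z)
    [IsProbabilityMeasure q] [IsProbabilityMeasure r] :
    relEnt q r = (InformationTheory.klDiv q r : EReal) := by
  unfold relEnt
  split_ifs with h
  · have h0 : 0 ≤ ∫ x, llr q r x ∂q := by
      simpa using InformationTheory.integral_llr_add_sub_measure_univ_nonneg h.1 h.2
    rw [InformationTheory.klDiv_of_ac_of_integrable h.1 h.2]
    simp [EReal.coe_ennreal_ofReal, h0]
  · have : InformationTheory.klDiv q r = ∞ :=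
      InformationTheory.klDiv_eq_top_iff.mpr fun h1 h2 => h ⟨h1, h2⟩
    simp [this]

theorem map_prodMap_compProd_comap {A B C : Type*} [MeasurableSpace A] [MeasurableSpace B]
    [MeasurableSpace C] (μ : Measure A) [IsProbabilityMeasure μ] (η : Kernel B C)
    [IsMarkovKernel η] {f : A → B} (hf : Measurable f) :
    (μ ⊗ₘ η.comap f hf).map (Prod.map f id) = μ.map f ⊗ₘ η := by
  have hfi : Measurable (Prod.map f (id : C → C)) := hf.prodMap measurable_id
  have : IsProbabilityMeasure (μ.map f) := Measure.isProbabilityMeasure_map hf.aemeasurable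
  ext s hs
  rw [Measure.map_apply hfi hs, Measure.compProd_apply (hfi hs), Measure.compProd_apply hs,
    lintegral_map (Kernel.measurable_kernel_prodMk_left hs) hf]
  rfl

/-- If, under the second measure, the conditional law of the second coordinate given the first one
depends on the first one only through `f`, then the conditional relative entropy decreases when the
first coordinate is replaced by its image under `f`. The inequality is written without
subtraction. -/
theorem klDiv_map_prodMap_add_le {A B C : Type*} [MeasurableSpace A] [MeasurableSpace B]
    [MeasurableSpace C] [StandardBorelSpace C] [Nonempty C]
    (μ : Measure (A × C)) [IsProbabilityMeasure μ] (ν : Measure A) [IsProbabilityMeasure ν]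
    (η : Kernel B C) [IsMarkovKernel η] {f : A → B} (hf : Measurable f) :
    InformationTheory.klDiv (μ.map (Prod.map f id)) (ν.map f ⊗ₘ η) +
        InformationTheory.klDiv μ.fst ν ≤
      InformationTheory.klDiv μ (ν ⊗ₘ η.comap f hf) +
        InformationTheory.klDiv (μ.fst.map f) (ν.map f) := by
  have hfi : Measurable (Prod.map f (id : C → C)) := hf.prodMap measurable_id
  have : IsProbabilityMeasure (μ.map (Prod.map f id)) :=
    Measure.isProbabilityMeasure_map hfi.aemeasurable
  have : IsProbabilityMeasure (ν.map f) := Measure.isProbabilityMeasure_map hf.aemeasurable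
  have hfst : (μ.map (Prod.map f id)).fst = μ.fst.map f := by
    rw [Measure.fst, Measure.fst, Measure.map_map measurable_fst hfi,
      Measure.map_map hf measurable_fst]
    rfl
  have h1 := InformationTheory.klDiv_compProd_eq_add μ.fst ν μ.condKernel (η.comap f hf)
  have h2 := InformationTheory.klDiv_compProd_eq_add (μ.map (Prod.map f id)).fst (ν.map f)
    (μ.map (Prod.map f id)).condKernel η
  rw [Measure.disintegrate] at h1 h2
  rw [hfst] at h2
  have h3 := InformationTheory.klDiv_map_le μ (μ.fst ⊗ₘ η.comap f hf) hfi
  rw [map_prodMap_compProd_comap] at h3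
  rw [h1, h2]
  refine (add_le_add (add_le_add le_rfl h3) le_rfl).trans_eq ?_
  ring

section ChainStep

variable {X : ℕ → Type*} [∀ i, MeasurableSpace (X i)] [∀ i, TopologicalSpace (X i)]
  [∀ i, PolishSpace (X i)] [∀ i, BorelSpace (X i)] [∀ i, Nonempty (X i)]

theorem measurable_frontFun {Y : ℕ → Type*} [∀ i, MeasurableSpace (Y i)] {n i : ℕ} (h : i ≤ n) :
    Measurable (frontFun (X := Y) i h) :=
  measurable_pi_lambda _ fun _ => measurable_pi_apply _

theorem coordFun_frontFun {Y : ℕ → Type*} [∀ i, Nonempty (Y i)] {n k i : ℕ} (hk : k ≤ n)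
    (hi : i < k) (ω : ∀ j : Fin n, Y j) :
    coordFun (frontFun k hk ω) i = coordFun ω i := by
  simp [coordFun, frontFun, hi, hi.trans_le hk]

theorem klDiv_pairMarg_zero_le {n : ℕ} (hn : 2 ≤ n) (P R : Measure (∀ j : Fin n, X j))
    [IsProbabilityMeasure P] [IsProbabilityMeasure R] :
    InformationTheory.klDiv (pairMarg P 0) (pairMarg R 0) ≤
      InformationTheory.klDiv (frontMarg P 2 hn) (frontMarg R 2 hn) := by
  have hg : Measurable fun ω : ∀ j : Fin 2, X j => (coordFun ω 0, coordFun ω 1) :=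
    measurable_coordFun.prodMk measurable_coordFun
  have key (Q : Measure (∀ j : Fin n, X j)) :
      pairMarg Q 0 = (frontMarg Q 2 hn).map fun ω => (coordFun ω 0, coordFun ω 1) := by
    rw [frontMarg, Measure.map_map hg (measurable_frontFun hn), pairMarg]
    congr 1
    funext ω
    simp only [Function.comp, coordFun_frontFun hn Nat.zero_lt_two,
      coordFun_frontFun hn Nat.one_lt_two]
  rw [key P, key R]
  exact InformationTheory.klDiv_map_le _ _ hg

theorem klDiv_frontPairMarg_le {n k : ℕ} (hk : k < n) (P R : Measure (∀ j : Fin n, X j))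
    [IsProbabilityMeasure P] [IsProbabilityMeasure R] :
    InformationTheory.klDiv (frontPairMarg P k hk) (frontPairMarg R k hk) ≤
      InformationTheory.klDiv (frontMarg P (k + 1) hk) (frontMarg R (k + 1) hk) := by
  have hg : Measurable fun ω : ∀ j : Fin (k + 1), X j =>
      (frontFun k k.le_succ ω, coordFun ω k) :=
    (measurable_frontFun k.le_succ).prodMk measurable_coordFun
  have key (Q : Measure (∀ j : Fin n, X j)) :
      frontPairMarg Q k hk =
        (frontMarg Q (k + 1) hk).map fun ω => (frontFun k k.le_succ ω, coordFun ω k) := by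
    rw [frontMarg, Measure.map_map hg (measurable_frontFun hk), frontPairMarg]
    congr 1
    funext ω
    simp only [Function.comp, coordFun_frontFun hk k.lt_succ_self]
    rfl
  rw [key P, key R]
  exact InformationTheory.klDiv_map_le _ _ hg

theorem klDiv_pairMarg_add_frontMarg_le {n m : ℕ} (hm : 1 ≤ m) (hk : m + 1 < n)
    (P R : Measure (∀ j : Fin n, X j))
    [IsProbabilityMeasure P] [IsProbabilityMeasure R] (hR : IsMarkovian R) :
    InformationTheory.klDiv (pairMarg P m) (pairMarg R m) +
        InformationTheory.klDiv (frontMarg P (m + 1) hk.le) (frontMarg R (m + 1) hk.le) ≤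
      InformationTheory.klDiv (frontMarg P (m + 2) hk) (frontMarg R (m + 2) hk) +
        InformationTheory.klDiv (singleMarg P m) (singleMarg R m) := by
  have hfront := measurable_frontFun (Y := X) hk.le
  have hcoord : Measurable fun x : ∀ j : Fin (m + 1), X j => coordFun x m := measurable_coordFun
  have hpair : Measurable fun ω : ∀ j : Fin n, X j =>
      (frontFun (m + 1) hk.le ω, coordFun ω (m + 1)) := hfront.prodMk measurable_coordFun
  have hfst (Q : Measure (∀ j : Fin n, X j)) :
      (frontPairMarg Q (m + 1) hk).fst = frontMarg Q (m + 1) hk.le :=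
    Measure.fst_map_prodMk measurable_coordFun
  have hsingle (Q : Measure (∀ j : Fin n, X j)) :
      (frontMarg Q (m + 1) hk.le).map (fun x => coordFun x m) = singleMarg Q m := by
    rw [frontMarg, Measure.map_map hcoord hfront, singleMarg]
    congr 1
    funext ω
    exact coordFun_frontFun hk.le m.lt_succ_self ω
  have hadj (Q : Measure (∀ j : Fin n, X j)) :
      (frontPairMarg Q (m + 1) hk).map (Prod.map (fun x => coordFun x m) id) =
        pairMarg Q m := by
    rw [frontPairMarg, Measure.map_map (hcoord.prodMap measurable_id) hpair, pairMarg]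
    congr 1
    funext ω
    simp only [Function.comp, Prod.map, coordFun_frontFun hk.le m.lt_succ_self, id]
  have : IsProbabilityMeasure (frontPairMarg P (m + 1) hk) :=
    Measure.isProbabilityMeasure_map hpair.aemeasurable
  have : IsProbabilityMeasure (frontMarg R (m + 1) hk.le) :=
    Measure.isProbabilityMeasure_map hfront.aemeasurable
  obtain ⟨η, _, hη⟩ : ∃ η : Kernel (X m) (X (m + 1)), IsMarkovKernel η ∧
      frontPairMarg R (m + 1) hk = frontMarg R (m + 1) hk.le ⊗ₘ η.comap _ hcoord :=
    ⟨(adjMarg R (m + 1)).condKernel,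
      inferInstanceAs (IsMarkovKernel (adjMarg R (m + 1)).condKernel),
      hR (m + 1) (by omega) hk⟩
  have h := klDiv_map_prodMap_add_le (frontPairMarg P (m + 1) hk) (frontMarg R (m + 1) hk.le)
    η hcoord
  rw [← map_prodMap_compProd_comap _ _ hcoord, ← hη, hadj, hadj, hfst, hsingle, hsingle] at h
  exact h.trans (by gcongr; exact klDiv_frontPairMarg_le hk P R)

theorem sum_klDiv_pairMarg_le {n : ℕ} (P R : Measure (∀ j : Fin n, X j))
    [IsProbabilityMeasure P] [IsProbabilityMeasure R] (hR : IsMarkovian R) (m : ℕ)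
    (hm : m + 2 ≤ n) :
    ∑ i ∈ Finset.range (m + 1), InformationTheory.klDiv (pairMarg P i) (pairMarg R i) ≤
      InformationTheory.klDiv (frontMarg P (m + 2) hm) (frontMarg R (m + 2) hm) +
        ∑ i ∈ Finset.Ico 1 (m + 1),
          InformationTheory.klDiv (singleMarg P i) (singleMarg R i) := by
  induction m with
  | zero => simpa using klDiv_pairMarg_zero_le hm P R
  | succ m ih =>
    have h := klDiv_pairMarg_add_frontMarg_le (m := m + 1) (by omega) hm P R hR
    rw [Finset.sum_range_succ, Finset.sum_Ico_succ_top (by omega),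
      add_comm (∑ i ∈ Finset.Ico _ _, _), ← add_assoc]
    refine le_trans ?_ (add_le_add_left h _)
    refine (add_le_add (ih (by omega)) le_rfl).trans_eq ?_
    ring

end ChainStep

set_option synthInstance.maxHeartbeats 1000000 in
set_option maxHeartbeats 1000000 in
/-- Lemma `lemmarkov`, inequality: if `R` is Markovian then
`H(P|R) ≥ ∑_{i=1}^{n-1} H(P_{i,i+1}|R_{i,i+1}) - ∑_{i=2}^{n-1} H(P_i|R_i)`
(stated in the equivalent rearranged form avoiding `∞ - ∞`). -/
theorem relEnt_ge_sum_pairs_sub_sum_marginals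
    {X : ℕ → Type*} [∀ i, MeasurableSpace (X i)] [∀ i, TopologicalSpace (X i)]
    [∀ i, PolishSpace (X i)] [∀ i, BorelSpace (X i)] [∀ i, Nonempty (X i)]
    (n : ℕ) (hn : 2 ≤ n) (P R : Measure (∀ j : Fin n, X j))
    [IsProbabilityMeasure P] [IsProbabilityMeasure R]
    (hR : IsMarkovian R) :
    ∑ i ∈ Finset.range (n - 1), relEnt (pairMarg P i) (pairMarg R i) ≤
      relEnt P R + ∑ i ∈ Finset.Ico 1 (n - 1), relEnt (singleMarg P i) (singleMarg R i) := by
  obtain ⟨m, rfl⟩ : ∃ m, n = m + 2 := ⟨n - 2, by omega⟩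
  have hpair (i : ℕ) : relEnt (pairMarg P i) (pairMarg R i) =
      (InformationTheory.klDiv (pairMarg P i) (pairMarg R i) : EReal) := by
    have hmeas : Measurable fun ω : ∀ j : Fin (m + 2), X j => (coordFun ω i, coordFun ω (i + 1)) :=
      measurable_coordFun.prodMk measurable_coordFun
    have : IsProbabilityMeasure (pairMarg P i) :=
      Measure.isProbabilityMeasure_map hmeas.aemeasurable
    have : IsProbabilityMeasure (pairMarg R i) :=
      Measure.isProbabilityMeasure_map hmeas.aemeasurable
    exact relEnt_eq_klDiv _ _
  have hsingle (i : ℕ) : relEnt (singleMarg P i) (singleMarg R i) =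
      (InformationTheory.klDiv (singleMarg P i) (singleMarg R i) : EReal) := by
    have hmeas : Measurable fun ω : ∀ j : Fin (m + 2), X j => coordFun ω i := measurable_coordFun
    have : IsProbabilityMeasure (singleMarg P i) :=
      Measure.isProbabilityMeasure_map hmeas.aemeasurable
    have : IsProbabilityMeasure (singleMarg R i) :=
      Measure.isProbabilityMeasure_map hmeas.aemeasurable
    exact relEnt_eq_klDiv _ _
  have hfront (Q : Measure (∀ j : Fin (m + 2), X j)) : frontMarg Q (m + 2) le_rfl = Q :=
    Measure.map_id
  have h := sum_klDiv_pairMarg_le P R hR m le_rfl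
  rw [hfront, hfront] at h
  simp only [hpair, hsingle, relEnt_eq_klDiv P R, Nat.add_succ_sub_one]
  rw [← EReal.coe_ennreal_sum, ← EReal.coe_ennreal_sum]
  exact_mod_cast h
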